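/- For every odd integer n ≥ 3 there exists a₀ > 0 such that for all a with 0 < a < a₀, the real polynomial equation xⁿ − x^{n−2} − aⁿ = 0 has exactly three real solutions. -/

import Mathlib

lemma hasDerivAt_pow_sub_pow_add_two (m : ℕ) (y : ℝ) :
    HasDerivAt (fun y : ℝ => y ^ (m + 1) - y ^ (m + 3))
      (y ^ m * ((m + 1) - (m + 3) * y ^ 2)) y := by
  refine ((hasDerivAt_pow (m + 1) y).sub (hasDerivAt_pow (m + 3) y)).congr_deriv ?_
  rw [Nat.add_sub_cancel, show m + 3 - 1 = m + 2 by omega]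
  push_cast
  ring

lemma strictMonoOn_pow_sub_pow_add_two (m : ℕ) {p : ℝ} (hp : (m + 3) * p ^ 2 = m + 1) :
    StrictMonoOn (fun y : ℝ => y ^ (m + 1) - y ^ (m + 3)) (Set.Icc 0 p) := by
  refine strictMonoOn_of_deriv_pos (convex_Icc 0 p) (by fun_prop) fun y hy => ?_
  rw [interior_Icc] at hy
  rw [(hasDerivAt_pow_sub_pow_add_two m y).deriv]
  have hsq : y ^ 2 < p ^ 2 := pow_lt_pow_left₀ hy.2 hy.1.le two_ne_zero
  have hm : (m + 3 : ℝ) * y ^ 2 < (m + 3) * p ^ 2 := by gcongr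
  exact mul_pos (pow_pos hy.1 m) (by linarith)

lemma strictAntiOn_pow_sub_pow_add_two (m : ℕ) {p : ℝ} (hp0 : 0 < p)
    (hp : (m + 3) * p ^ 2 = m + 1) :
    StrictAntiOn (fun y : ℝ => y ^ (m + 1) - y ^ (m + 3)) (Set.Ici p) := by
  refine strictAntiOn_of_deriv_neg (convex_Ici p) (by fun_prop) fun y hy => ?_
  rw [interior_Ici] at hy
  have hpy : p < y := hy
  rw [(hasDerivAt_pow_sub_pow_add_two m y).deriv]
  have hsq : p ^ 2 < y ^ 2 := pow_lt_pow_left₀ hpy hp0.le two_ne_zero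
  have hm : (m + 3 : ℝ) * p ^ 2 < (m + 3) * y ^ 2 := by gcongr
  exact mul_neg_of_pos_of_neg (pow_pos (hp0.trans hpy) m) (by linarith)

/-- For every odd `n ≥ 3` there is `a₀ > 0` such that for all
`0 < a < a₀`, the real equation `xⁿ - x^(n-2) - aⁿ = 0` has exactly three real
solutions. -/
theorem odd_case_three_real_solutions (n : ℕ) (hn : 3 ≤ n) (hodd : Odd n) :
    ∃ a₀ : ℝ, 0 < a₀ ∧ ∀ a : ℝ, 0 < a → a < a₀ →
      {x : ℝ | x ^ n - x ^ (n - 2) - a ^ n = 0}.Finite ∧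
      {x : ℝ | x ^ n - x ^ (n - 2) - a ^ n = 0}.ncard = 3 := by
  obtain ⟨m, rfl⟩ := Nat.exists_eq_add_of_le' hn
  have hodd' : Odd (m + 1) := by
    obtain ⟨k, hk⟩ := hodd
    exact ⟨k - 1, by omega⟩
  rw [show m + 3 - 2 = m + 1 by omega]
  obtain ⟨p, hp0, hp⟩ : ∃ p : ℝ, 0 < p ∧ (m + 3) * p ^ 2 = m + 1 := by
    refine ⟨√((m + 1) / (m + 3)), by positivity, ?_⟩
    rw [Real.sq_sqrt (by positivity)]
    field_simp
  have hp1 : p < 1 := by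
    by_contra! h
    nlinarith [one_le_pow₀ h (n := 2), (Nat.cast_nonneg m : (0 : ℝ) ≤ m)]
  set g : ℝ → ℝ := fun y => y ^ (m + 1) - y ^ (m + 3) with hg
  have hmono : StrictMonoOn g (Set.Icc 0 p) := strictMonoOn_pow_sub_pow_add_two m hp
  have hanti : StrictAntiOn g (Set.Ici p) := strictAntiOn_pow_sub_pow_add_two m hp0 hp
  have hcont : Continuous g := by fun_prop
  have hg0 : g 0 = 0 := by simp [hg]
  have hg1 : g 1 = 0 := by simp [hg]
  have hg2 : g 2 ≤ -1 := by
    have h := one_le_pow₀ (one_le_two : (1 : ℝ) ≤ 2) (n := m)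
    simp only [hg, pow_add]
    linarith
  have hgp : 0 < g p := hg0 ▸ hmono ⟨le_rfl, hp0.le⟩ ⟨hp0.le, le_rfl⟩ hp0
  refine ⟨min 1 (g p), lt_min one_pos hgp, fun a ha0 ha => ?_⟩
  obtain ⟨ha1, hap⟩ := lt_min_iff.mp ha
  have hc0 : 0 < a ^ (m + 3) := pow_pos ha0 _
  have hca : a ^ (m + 3) ≤ a := pow_le_of_le_one ha0.le ha1.le (by omega)
  generalize a ^ (m + 3) = c at hc0 hca
  obtain ⟨y₁, hy₁, hgy₁⟩ : c ∈ g '' Set.Ioo 0 p :=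
    intermediate_value_Ioo hp0.le hcont.continuousOn ⟨by linarith, by linarith⟩
  obtain ⟨y₂, hy₂, hgy₂⟩ : c ∈ g '' Set.Ioo p 1 :=
    intermediate_value_Ioo' hp1.le hcont.continuousOn ⟨by linarith, by linarith⟩
  obtain ⟨y₃, hy₃, hgy₃⟩ : -c ∈ g '' Set.Ioo 1 2 :=
    intermediate_value_Ioo' one_le_two hcont.continuousOn ⟨by linarith, by linarith⟩
  have hneg (x : ℝ) : g (-x) = -g x := by
    simp only [hg, hodd'.neg_pow, hodd.neg_pow]
    ring
  have hroots : {x : ℝ | x ^ (m + 3) - x ^ (m + 1) - c = 0} = {-y₁, -y₂, y₃} := by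
    ext x
    have hx : x ^ (m + 3) - x ^ (m + 1) - c = 0 ↔ g x = -c := by
      simp only [hg]
      constructor <;> intro h <;> linarith
    simp only [Set.mem_ofPred_eq, Set.mem_insert_iff, Set.mem_singleton_iff, hx]
    constructor
    · intro h
      rcases le_or_gt x 0 with hx0 | hx0
      · have h' : g (-x) = c := by rw [hneg, h, neg_neg]
        rcases le_total (-x) p with hxp | hxp
        · left
          have := hmono.injOn ⟨neg_nonneg.mpr hx0, hxp⟩ ⟨hy₁.1.le, hy₁.2.le⟩ (h'.trans hgy₁.symm)
          linarith
        · right; left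
          have := hanti.injOn hxp hy₂.1.le (h'.trans hgy₂.symm)
          linarith
      · right; right
        rcases le_total x p with hxp | hxp
        · have := hmono ⟨le_rfl, hp0.le⟩ ⟨hx0.le, hxp⟩ hx0
          linarith
        · exact hanti.injOn hxp (hp1.trans hy₃.1).le (h.trans hgy₃.symm)
    · rintro (rfl | rfl | rfl)
      · rw [hneg, hgy₁]
      · rw [hneg, hgy₂]
      · exact hgy₃
  rw [hroots]
  refine ⟨Set.toFinite _, Set.ncard_eq_three.mpr ⟨-y₁, -y₂, y₃, ?_, ?_, ?_, rfl⟩⟩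
  · exact fun h => by linarith [hy₁.2, hy₂.1]
  · exact fun h => by linarith [hy₁.1, hy₃.1]
  · exact fun h => by linarith [hy₂.1, hy₃.1]
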